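/- arXiv:2410.06797 — 2 statements merged into one kernel-verified Lean document; each statement's English description precedes it below -/
import Mathlib

section
/- Let (P,φ) be a P-NE pair. If B^{--} = ∅ and β̄_d^P(φ) ≤ β̄_u^P(φ), then (P,φ) is stable at cost β if and only if β ∈ [β̄_d^P(φ), β̄_u^P(φ)]. -/
open Finset

namespace CG

variable {N M : ℕ}

/-- Number of players choosing link `a` under profile `φ`. -/
def gamma (φ : Fin N → Fin M) (a : Fin M) : ℕ :=
  (Finset.univ.filter fun i => φ i = a).card

/-- Utility of coalition `C` under profile `φ` at per-communication cost `β`. -/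
noncomputable def util (μ : Fin M → ℕ → ℝ) (β : ℝ) (C : Finset (Fin N))
    (φ : Fin N → Fin M) : ℝ :=
  (∑ i ∈ C, μ (φ i) (gamma φ (φ i))) - ((C.card : ℝ) - 1) * β

/-- `P` is a partition of the player set into (nonempty, pairwise disjoint) coalitions. -/
def IsPartition (P : Finset (Finset (Fin N))) : Prop :=
  (∀ C ∈ P, C.Nonempty) ∧
  (∀ C ∈ P, ∀ C' ∈ P, C ≠ C' → Disjoint C C') ∧
  (∀ i : Fin N, ∃ C ∈ P, i ∈ C)

/-- `φ` is a Nash equilibrium for partition `P`: no coalition of `P` can strictly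
improve its utility by unilaterally changing the strategies of its own members. -/
def IsNE (μ : Fin M → ℕ → ℝ) (β : ℝ) (P : Finset (Finset (Fin N)))
    (φ : Fin N → Fin M) : Prop :=
  ∀ C ∈ P, ∀ φ' : Fin N → Fin M, (∀ i ∉ C, φ' i = φ i) →
    util μ β C φ' ≤ util μ β C φ

/-- Pessimal anticipated worth of a coalition `C`. -/
noncomputable def pess (μ : Fin M → ℕ → ℝ) (β : ℝ) (C : Finset (Fin N)) : ℝ :=
  sInf {x : ℝ | ∃ P' : Finset (Finset (Fin N)), ∃ φ' : Fin N → Fin M,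
    IsPartition P' ∧ C ∈ P' ∧ IsNE μ β P' φ' ∧ x = util μ β C φ'}

/-- `ψ` is a payoff vector consistent with `(P, φ)`. -/
def Consistent (μ : Fin M → ℕ → ℝ) (β : ℝ) (P : Finset (Finset (Fin N)))
    (φ : Fin N → Fin M) (ψ : Fin N → ℝ) : Prop :=
  (∀ j, 0 ≤ ψ j) ∧ ∀ C ∈ P, ∑ j ∈ C, ψ j = util μ β C φ

/-- Coalition `C ∉ P` blocks the configuration with payoff vector `ψ`. -/
def Blocks (μ : Fin M → ℕ → ℝ) (β : ℝ) (P : Finset (Finset (Fin N)))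
    (ψ : Fin N → ℝ) (C : Finset (Fin N)) : Prop :=
  C.Nonempty ∧ C ∉ P ∧ ∑ j ∈ C, ψ j < pess μ β C

/-- The configuration `(P, φ, ψ)` is stable. -/
def ConfigStable (μ : Fin M → ℕ → ℝ) (β : ℝ) (P : Finset (Finset (Fin N)))
    (φ : Fin N → Fin M) (ψ : Fin N → ℝ) : Prop :=
  IsPartition P ∧ IsNE μ β P φ ∧ Consistent μ β P φ ψ ∧
    ∀ C : Finset (Fin N), ¬ Blocks μ β P ψ C

/-- The P-NE pair `(P, φ)` is stable. -/
def PairStable (μ : Fin M → ℕ → ℝ) (β : ℝ) (P : Finset (Finset (Fin N)))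
    (φ : Fin N → Fin M) : Prop :=
  ∃ ψ : Fin N → ℝ, ConfigStable μ β P φ ψ

/-- The partition `P` is stable. -/
def PartStable (μ : Fin M → ℕ → ℝ) (β : ℝ) (P : Finset (Finset (Fin N))) : Prop :=
  ∃ φ : Fin N → Fin M, PairStable μ β P φ

/-- The ALC partition, in which every player is a singleton coalition. -/
def ALC (N : ℕ) : Finset (Finset (Fin N)) :=
  Finset.univ.image fun i => ({i} : Finset (Fin N))

/-- `D_C^P = Σ_i q_i(C)/l_i − 1`. -/
noncomputable def Dcoef (P : Finset (Finset (Fin N))) (C : Finset (Fin N)) : ℝ :=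
  (∑ Ci ∈ P, ((Ci ∩ C).card : ℝ) / (Ci.card : ℝ)) - 1

/-- `Γ_C^P(φ) = Σ_i (q_i(C)/l_i) ν_{C_i}^{0,P}(φ) − ν̲_C^0`. -/
noncomputable def Gam (μ : Fin M → ℕ → ℝ) (P : Finset (Finset (Fin N)))
    (φ : Fin N → Fin M) (C : Finset (Fin N)) : ℝ :=
  (∑ Ci ∈ P, ((Ci ∩ C).card : ℝ) / (Ci.card : ℝ) * util μ 0 Ci φ) - pess μ 0 C

/-- `B^{--}`. -/
def Bmm (μ : Fin M → ℕ → ℝ) (P : Finset (Finset (Fin N))) (φ : Fin N → Fin M) :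
    Set (Finset (Fin N)) :=
  {C | (C.Nonempty ∧ C ∉ P) ∧ Dcoef P C ≤ 0 ∧ Gam μ P φ C < 0}

/-- `B^{+-}`. -/
def Bpm (μ : Fin M → ℕ → ℝ) (P : Finset (Finset (Fin N))) (φ : Fin N → Fin M) :
    Set (Finset (Fin N)) :=
  {C | (C.Nonempty ∧ C ∉ P) ∧ 0 < Dcoef P C ∧ Gam μ P φ C < 0}

/-- `B^{-+}`. -/
def Bmp (μ : Fin M → ℕ → ℝ) (P : Finset (Finset (Fin N))) (φ : Fin N → Fin M) :
    Set (Finset (Fin N)) :=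
  {C | (C.Nonempty ∧ C ∉ P) ∧ Dcoef P C < 0 ∧ 0 ≤ Gam μ P φ C}

/-- `β̄_u^P(φ) = min_{C ∈ B^{-+}} (−Γ_C^P(φ)/D_C^P)`, with `min ∅ = +∞` (in `EReal`). -/
noncomputable def betaU (μ : Fin M → ℕ → ℝ) (P : Finset (Finset (Fin N)))
    (φ : Fin N → Fin M) : EReal :=
  sInf ((fun C => ((-(Gam μ P φ C) / Dcoef P C : ℝ) : EReal)) '' Bmp μ P φ)

/-- `β̄_d^P(φ) = max_{C ∈ B^{+-}} (−Γ_C^P(φ)/D_C^P)`, with `max ∅ = 0` (in `EReal`). -/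
noncomputable def betaD (μ : Fin M → ℕ → ℝ) (P : Finset (Finset (Fin N)))
    (φ : Fin N → Fin M) : EReal :=
  sSup (insert (0 : EReal)
    ((fun C => ((-(Gam μ P φ C) / Dcoef P C : ℝ) : EReal)) '' Bpm μ P φ))

end CG
namespace CG

variable {N M : ℕ}

lemma util_eq_util_zero_sub (μ : Fin M → ℕ → ℝ) (β : ℝ) (C : Finset (Fin N))
    (φ : Fin N → Fin M) :
    util μ β C φ = util μ 0 C φ - ((C.card : ℝ) - 1) * β := by
  simp [util]

lemma isNE_iff_isNE_zero (μ : Fin M → ℕ → ℝ) (β : ℝ) (P : Finset (Finset (Fin N)))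
    (φ : Fin N → Fin M) : IsNE μ β P φ ↔ IsNE μ 0 P φ := by
  simp [IsNE, util]

lemma util_zero_nonneg {μ : Fin M → ℕ → ℝ}
    (hpos : ∀ a : Fin M, ∀ k : ℕ, 1 ≤ k → k ≤ N → 0 < μ a k)
    (C : Finset (Fin N)) (φ : Fin N → Fin M) : 0 ≤ util μ 0 C φ := by
  simp only [util, mul_zero, sub_zero]
  refine Finset.sum_nonneg fun i _ => (hpos _ _ ?_ ?_).le
  · exact Finset.card_pos.mpr ⟨i, by simp⟩
  · simpa [gamma] using Finset.card_filter_le (Finset.univ : Finset (Fin N)) (φ · = φ i)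

/-- The worths attained by `C` at the equilibria of the partitions containing `C`. -/
def worths (μ : Fin M → ℕ → ℝ) (β : ℝ) (C : Finset (Fin N)) : Set ℝ :=
  {x : ℝ | ∃ P' : Finset (Finset (Fin N)), ∃ φ' : Fin N → Fin M,
    IsPartition P' ∧ C ∈ P' ∧ IsNE μ β P' φ' ∧ x = util μ β C φ'}

lemma pess_eq_sInf (μ : Fin M → ℕ → ℝ) (β : ℝ) (C : Finset (Fin N)) :
    pess μ β C = sInf (worths μ β C) := rfl

lemma worths_eq_image (μ : Fin M → ℕ → ℝ) (β : ℝ) (C : Finset (Fin N)) :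
    worths μ β C = OrderIso.subRight (((C.card : ℝ) - 1) * β) '' worths μ 0 C := by
  ext x
  constructor
  · rintro ⟨P', φ', h1, h2, h3, rfl⟩
    exact ⟨_, ⟨P', φ', h1, h2, (isNE_iff_isNE_zero ..).1 h3, rfl⟩,
      (util_eq_util_zero_sub μ β C φ').symm⟩
  · rintro ⟨_, ⟨P', φ', h1, h2, h3, rfl⟩, rfl⟩
    exact ⟨P', φ', h1, h2, (isNE_iff_isNE_zero ..).2 h3,
      (util_eq_util_zero_sub μ β C φ').symm⟩

lemma worths_zero_nonneg {μ : Fin M → ℕ → ℝ}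
    (hpos : ∀ a : Fin M, ∀ k : ℕ, 1 ≤ k → k ≤ N → 0 < μ a k)
    (C : Finset (Fin N)) : ∀ x ∈ worths μ 0 C, 0 ≤ x := by
  rintro _ ⟨P', φ', -, -, -, rfl⟩
  exact util_zero_nonneg hpos C φ'

lemma pess_zero_nonneg {μ : Fin M → ℕ → ℝ}
    (hpos : ∀ a : Fin M, ∀ k : ℕ, 1 ≤ k → k ≤ N → 0 < μ a k)
    (C : Finset (Fin N)) : 0 ≤ pess μ 0 C :=
  Real.sInf_nonneg (worths_zero_nonneg hpos C)

/-- The second alternative is the junk value of `sInf` when no partition containing `C` has an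
equilibrium. -/
lemma pess_eq_or {μ : Fin M → ℕ → ℝ}
    (hpos : ∀ a : Fin M, ∀ k : ℕ, 1 ≤ k → k ≤ N → 0 < μ a k)
    (β : ℝ) (C : Finset (Fin N)) :
    pess μ β C = pess μ 0 C - ((C.card : ℝ) - 1) * β ∨
      (pess μ β C = 0 ∧ pess μ 0 C = 0) := by
  rw [pess_eq_sInf, pess_eq_sInf, worths_eq_image μ β C]
  rcases (worths μ 0 C).eq_empty_or_nonempty with h | h
  · right
    simp [h]
  · left
    exact ((OrderIso.subRight (((C.card : ℝ) - 1) * β)).map_csInf' h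
      ⟨0, worths_zero_nonneg hpos C⟩).symm

lemma util_map (μ : Fin M → ℕ → ℝ) (β : ℝ) (C : Finset (Fin N)) (φ : Fin N → Fin M)
    (σ : Equiv.Perm (Fin N)) :
    util μ β (C.map σ.toEmbedding) φ = util μ β C (φ ∘ σ) := by
  have h (a : Fin M) : gamma (φ ∘ σ) a = gamma φ a := by
    unfold gamma
    exact Finset.card_equiv σ (by simp)
  simp [util, h]

lemma IsPartition.map {P : Finset (Finset (Fin N))} (hP : IsPartition P)
    (σ : Equiv.Perm (Fin N)) :
    IsPartition (P.image fun C => C.map σ.toEmbedding) := by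
  refine ⟨?_, ?_, fun i => ?_⟩
  · simpa using hP.1
  · simp only [Finset.mem_image, forall_exists_index, and_imp, forall_apply_eq_imp_iff₂]
    intro C hC C' hC' hne
    exact (Finset.disjoint_map _).2 (hP.2.1 C hC C' hC' fun h => hne (by rw [h]))
  · obtain ⟨C, hC, hi⟩ := hP.2.2 (σ.symm i)
    exact ⟨_, Finset.mem_image_of_mem _ hC, by simpa [Finset.mem_map_equiv] using hi⟩

lemma IsNE.map {μ : Fin M → ℕ → ℝ} {β : ℝ} {P : Finset (Finset (Fin N))}
    {φ : Fin N → Fin M} (h : IsNE μ β P φ) (σ : Equiv.Perm (Fin N)) :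
    IsNE μ β (P.image fun C => C.map σ.toEmbedding) (φ ∘ σ.symm) := by
  simp only [IsNE, Finset.mem_image, forall_exists_index, and_imp, forall_apply_eq_imp_iff₂]
  intro C hC φ' hφ'
  rw [util_map, util_map]
  have hφ : (φ ∘ σ.symm) ∘ σ = φ := by ext; simp
  rw [hφ]
  refine h C hC _ fun i hi => ?_
  simpa using hφ' (σ i) (by simpa using hi)

lemma worths_subset_worths_map (μ : Fin M → ℕ → ℝ) (β : ℝ) (C : Finset (Fin N))
    (σ : Equiv.Perm (Fin N)) :
    worths μ β C ⊆ worths μ β (C.map σ.toEmbedding) := by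
  rintro _ ⟨P', φ', h1, h2, h3, rfl⟩
  refine ⟨_, _, h1.map σ, Finset.mem_image_of_mem _ h2, h3.map σ, ?_⟩
  rw [util_map]
  congr 1
  ext
  simp

lemma pess_map (μ : Fin M → ℕ → ℝ) (β : ℝ) (C : Finset (Fin N))
    (σ : Equiv.Perm (Fin N)) :
    pess μ β (C.map σ.toEmbedding) = pess μ β C := by
  rw [pess_eq_sInf, pess_eq_sInf]
  congr 1
  refine Set.Subset.antisymm ?_ (worths_subset_worths_map μ β C σ)
  have h := worths_subset_worths_map μ β (C.map σ.toEmbedding) σ.symm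
  have hC : (C.map σ.toEmbedding).map σ.symm.toEmbedding = C := by
    ext
    simp [Finset.mem_map_equiv]
  rwa [hC] at h

section EqualShare

variable {P : Finset (Finset (Fin N))} {b : Fin N → Finset (Fin N)}

lemma filter_block_eq (hP : IsPartition P) (hbP : ∀ i, b i ∈ P) (hb : ∀ i, i ∈ b i)
    {B : Finset (Fin N)} (hB : B ∈ P) (C : Finset (Fin N)) :
    {j ∈ C | b j = B} = B ∩ C := by
  ext j
  simp only [Finset.mem_filter, Finset.mem_inter]
  constructor
  · rintro ⟨h, rfl⟩
    exact ⟨hb j, h⟩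
  · rintro ⟨h, h'⟩
    refine ⟨h', ?_⟩
    by_contra hne
    exact Finset.disjoint_left.1 (hP.2.1 _ (hbP j) _ hB hne) (hb j) h

lemma sum_comp_block (hP : IsPartition P) (hbP : ∀ i, b i ∈ P) (hb : ∀ i, i ∈ b i)
    (C : Finset (Fin N)) (f : Finset (Fin N) → ℝ) :
    ∑ j ∈ C, f (b j) = ∑ B ∈ P, ((B ∩ C).card : ℝ) * f B := by
  rw [← Finset.sum_fiberwise_of_maps_to (fun j _ => hbP j)]
  refine Finset.sum_congr rfl fun B hB => ?_
  rw [Finset.sum_congr rfl (g := fun _ => f B) fun j hj => by rw [(Finset.mem_filter.1 hj).2],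
    Finset.sum_const, filter_block_eq hP hbP hb hB, nsmul_eq_mul]

lemma sum_equal_share (hP : IsPartition P) (hbP : ∀ i, b i ∈ P) (hb : ∀ i, i ∈ b i)
    (μ : Fin M → ℕ → ℝ) (β : ℝ) (φ : Fin N → Fin M) (C : Finset (Fin N)) :
    ∑ j ∈ C, util μ β (b j) φ / ((b j).card : ℝ) =
      Gam μ P φ C + Dcoef P C * β + (pess μ 0 C - ((C.card : ℝ) - 1) * β) := by
  have hcard : (C.card : ℝ) = ∑ B ∈ P, ((B ∩ C).card : ℝ) := by
    simpa using sum_comp_block hP hbP hb C fun _ => 1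
  rw [sum_comp_block hP hbP hb C fun B => util μ β B φ / (B.card : ℝ), hcard]
  have h : ∑ B ∈ P, ((B ∩ C).card : ℝ) * (util μ β B φ / (B.card : ℝ)) =
      ∑ B ∈ P, ((B ∩ C).card : ℝ) / (B.card : ℝ) * util μ 0 B φ
        + (∑ B ∈ P, ((B ∩ C).card : ℝ) / (B.card : ℝ)) * β
        - (∑ B ∈ P, ((B ∩ C).card : ℝ)) * β := by
    rw [Finset.sum_mul, Finset.sum_mul, ← Finset.sum_add_distrib, ← Finset.sum_sub_distrib]
    refine Finset.sum_congr rfl fun B hB => ?_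
    have : (B.card : ℝ) ≠ 0 := by
      exact_mod_cast (Finset.card_pos.2 (hP.1 B hB)).ne'
    rw [util_eq_util_zero_sub μ β]
    field_simp
    ring
  rw [h, Gam, Dcoef]
  ring

/-- The permutations of the players preserving every block. -/
def blockPerms (b : Fin N → Finset (Fin N)) : Finset (Equiv.Perm (Fin N)) :=
  {σ | ∀ j, b (σ j) = b j}

lemma mem_blockPerms {σ : Equiv.Perm (Fin N)} : σ ∈ blockPerms b ↔ ∀ j, b (σ j) = b j := by
  simp [blockPerms]

lemma sum_blockPerms_congr (ψ : Fin N → ℝ) {i j : Fin N} (hij : b i = b j) :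
    ∑ σ ∈ blockPerms b, ψ (σ i) = ∑ σ ∈ blockPerms b, ψ (σ j) := by
  have hs (k : Fin N) : b (Equiv.swap i j k) = b k := by
    rw [Equiv.swap_apply_def]
    split_ifs with h h' <;> simp [*]
  refine Finset.sum_equiv (Equiv.mulRight (Equiv.swap i j)) (fun σ => ?_) (by simp)
  simp only [mem_blockPerms, Equiv.coe_mulRight, Equiv.Perm.mul_apply]
  refine ⟨fun h k => by rw [h, hs], fun h k => ?_⟩
  have := h (Equiv.swap i j k)
  rwa [Equiv.swap_apply_self, hs] at this

lemma map_block (hP : IsPartition P) (hbP : ∀ i, b i ∈ P) (hb : ∀ i, i ∈ b i)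
    {σ : Equiv.Perm (Fin N)} (hσ : σ ∈ blockPerms b) {B : Finset (Fin N)} (hB : B ∈ P) :
    B.map σ.toEmbedding = B := by
  have hmem (j : Fin N) : j ∈ B ↔ b j = B := by
    simpa using (Finset.ext_iff.1 (filter_block_eq hP hbP hb hB Finset.univ) j).symm
  refine Finset.eq_of_subset_of_card_le (fun k hk => ?_) (by simp)
  obtain ⟨j, hj, rfl⟩ := Finset.mem_map.1 hk
  rw [hmem] at hj ⊢
  exact (mem_blockPerms.1 hσ j).trans hj

/-- Averaging a payoff vector over the block-preserving permutations gives equal shares. -/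
lemma sum_blockPerms_apply (hP : IsPartition P) (hbP : ∀ i, b i ∈ P) (hb : ∀ i, i ∈ b i)
    {μ : Fin M → ℕ → ℝ} {β : ℝ} {φ : Fin N → Fin M} {ψ : Fin N → ℝ}
    (hψ : Consistent μ β P φ ψ) (j : Fin N) :
    ∑ σ ∈ blockPerms b, ψ (σ j) =
      (blockPerms b).card * (util μ β (b j) φ / ((b j).card : ℝ)) := by
  have hcard : ((b j).card : ℝ) ≠ 0 := by
    exact_mod_cast (Finset.card_pos.2 ⟨j, hb j⟩).ne'
  have h1 : ∑ k ∈ b j, ∑ σ ∈ blockPerms b, ψ (σ k) =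
      (b j).card * ∑ σ ∈ blockPerms b, ψ (σ j) := by
    rw [← nsmul_eq_mul, ← Finset.sum_const]
    refine Finset.sum_congr rfl fun k hk => sum_blockPerms_congr ψ ?_
    by_contra hne
    exact Finset.disjoint_left.1 (hP.2.1 _ (hbP k) _ (hbP j) hne) (hb k) hk
  have h2 : ∑ k ∈ b j, ∑ σ ∈ blockPerms b, ψ (σ k) =
      (blockPerms b).card * util μ β (b j) φ := by
    rw [Finset.sum_comm, ← nsmul_eq_mul, ← Finset.sum_const]
    refine Finset.sum_congr rfl fun σ hσ => ?_
    rw [← hψ.2 _ (hbP j)]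
    conv_rhs => rw [← map_block hP hbP hb hσ (hbP j)]
    simp
  rw [h1] at h2
  field_simp
  linarith

/-- If some payoff vector is stable, then so is the equal-share vector. -/
lemma pess_le_sum_equal_share (hP : IsPartition P) (hbP : ∀ i, b i ∈ P) (hb : ∀ i, i ∈ b i)
    {μ : Fin M → ℕ → ℝ} {β : ℝ} {φ : Fin N → Fin M} {ψ : Fin N → ℝ}
    (hψ : ConfigStable μ β P φ ψ) {C : Finset (Fin N)} (hC : C.Nonempty) (hCP : C ∉ P) :
    pess μ β C ≤ ∑ j ∈ C, util μ β (b j) φ / ((b j).card : ℝ) := by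
  obtain ⟨-, -, hcons, hst⟩ := hψ
  have hpos : (0 : ℝ) < (blockPerms b).card := by
    exact_mod_cast Finset.card_pos.2 ⟨1, mem_blockPerms.2 fun _ => rfl⟩
  refine le_of_mul_le_mul_left ?_ hpos
  rw [Finset.mul_sum, Finset.sum_congr rfl fun j _ => (sum_blockPerms_apply hP hbP hb hcons j).symm,
    Finset.sum_comm, ← nsmul_eq_mul, ← Finset.sum_const]
  refine Finset.sum_le_sum fun σ hσ => ?_
  have hσC : C.map σ.toEmbedding ∉ P := fun h =>
    hCP (by
      have := map_block hP hbP hb hσ h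
      rwa [← Finset.map_injective _ this])
  have := hst (C.map σ.toEmbedding)
  simp only [Blocks, Finset.map_nonempty, hC, hσC, not_false_eq_true, true_and, not_lt,
    pess_map, Finset.sum_map] at this
  exact this

/-- A pair is stable exactly when equal sharing is nonnegative in each block and unblocked. -/
lemma pairStable_iff (hP : IsPartition P) (hbP : ∀ i, b i ∈ P) (hb : ∀ i, i ∈ b i)
    {μ : Fin M → ℕ → ℝ} {β : ℝ} {φ : Fin N → Fin M} (hφ : IsNE μ β P φ) :
    PairStable μ β P φ ↔ (∀ j, 0 ≤ util μ β (b j) φ / ((b j).card : ℝ)) ∧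
      ∀ C : Finset (Fin N), C.Nonempty → C ∉ P →
        pess μ β C ≤ ∑ j ∈ C, util μ β (b j) φ / ((b j).card : ℝ) := by
  constructor
  · rintro ⟨ψ, hψ⟩
    refine ⟨fun j => ?_, fun C hC hCP => pess_le_sum_equal_share hP hbP hb hψ hC hCP⟩
    rw [← hψ.2.2.1.2 _ (hbP j)]
    exact div_nonneg (Finset.sum_nonneg fun k _ => hψ.2.2.1.1 k) (by positivity)
  · rintro ⟨hnn, hle⟩
    refine ⟨fun j => util μ β (b j) φ / ((b j).card : ℝ), hP, hφ, ⟨hnn, fun B hB => ?_⟩,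
      fun C ⟨hC, hCP, hlt⟩ => (hle C hC hCP).not_gt hlt⟩
    have hcard : (B.card : ℝ) ≠ 0 := by
      exact_mod_cast (Finset.card_pos.2 (hP.1 B hB)).ne'
    have hconst : ∀ j ∈ B, util μ β (b j) φ / ((b j).card : ℝ) =
        util μ β B φ / (B.card : ℝ) := fun j hj => by
      have : j ∈ ({j ∈ B | b j = B} : Finset (Fin N)) := by
        rw [filter_block_eq hP hbP hb hB]
        simpa using hj
      rw [(Finset.mem_filter.1 this).2]
    rw [Finset.sum_congr rfl hconst, Finset.sum_const, nsmul_eq_mul]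
    field_simp

end EqualShare

lemma pairStable_iff_forall_Gam {μ : Fin M → ℕ → ℝ}
    (hpos : ∀ a : Fin M, ∀ k : ℕ, 1 ≤ k → k ≤ N → 0 < μ a k)
    {P : Finset (Finset (Fin N))} (hP : IsPartition P) {φ : Fin N → Fin M}
    (hφ : IsNE μ 0 P φ) {β : ℝ} (hβ : 0 ≤ β) :
    PairStable μ β P φ ↔ ∀ C : Finset (Fin N), C.Nonempty → C ∉ P →
      0 ≤ Gam μ P φ C + Dcoef P C * β := by
  choose b hbP hb using hP.2.2
  rw [pairStable_iff hP hbP hb ((isNE_iff_isNE_zero ..).2 hφ)]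
  constructor
  · rintro ⟨hnn, hle⟩ C hC hCP
    have h1 := hle C hC hCP
    have h2 := sum_equal_share hP hbP hb μ β φ C
    rcases pess_eq_or hpos β C with h | ⟨-, h⟩
    · linarith
    · have h3 : 0 ≤ ∑ j ∈ C, util μ β (b j) φ / ((b j).card : ℝ) :=
        Finset.sum_nonneg fun j _ => hnn j
      have h4 : 0 ≤ ((C.card : ℝ) - 1) * β := by
        have : (1 : ℝ) ≤ C.card := by exact_mod_cast hC.card_pos
        exact mul_nonneg (by linarith) hβ
      linarith
  · intro h
    have hnn (j : Fin N) : 0 ≤ util μ β (b j) φ / ((b j).card : ℝ) := by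
      by_cases hj : {j} ∈ P
      · have hbj : b j = {j} := by
          by_contra hne
          exact Finset.disjoint_left.1 (hP.2.1 _ (hbP j) _ hj hne) (hb j) (by simp)
        rw [hbj, util_eq_util_zero_sub]
        simpa using util_zero_nonneg hpos {j} φ
      · have h1 := h {j} (by simp) hj
        have h2 := sum_equal_share hP hbP hb μ β φ {j}
        have h3 := pess_zero_nonneg hpos ({j} : Finset (Fin N))
        simp only [Finset.sum_singleton, Finset.card_singleton, Nat.cast_one, sub_self,
          zero_mul, sub_zero] at h2
        linarith
    refine ⟨hnn, fun C hC hCP => ?_⟩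
    rcases pess_eq_or hpos β C with h' | ⟨h', -⟩
    · rw [sum_equal_share hP hbP hb, h']
      linarith [h C hC hCP]
    · rw [h']
      exact Finset.sum_nonneg fun j _ => hnn j

lemma forall_Gam_iff {μ : Fin M → ℕ → ℝ} {P : Finset (Finset (Fin N))}
    {φ : Fin N → Fin M} (hBmm : Bmm μ P φ = ∅) {β : ℝ} (hβ : 0 ≤ β) :
    (∀ C : Finset (Fin N), C.Nonempty → C ∉ P → 0 ≤ Gam μ P φ C + Dcoef P C * β) ↔
      betaD μ P φ ≤ (β : EReal) ∧ (β : EReal) ≤ betaU μ P φ := by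
  have hD : betaD μ P φ ≤ (β : EReal) ↔
      ∀ C ∈ Bpm μ P φ, -(Gam μ P φ C) / Dcoef P C ≤ β := by
    simp [betaD, hβ]
  have hU : (β : EReal) ≤ betaU μ P φ ↔
      ∀ C ∈ Bmp μ P φ, β ≤ -(Gam μ P φ C) / Dcoef P C := by
    simp [betaU]
  rw [hD, hU]
  constructor
  · refine fun h => ⟨fun C hC => ?_, fun C hC => ?_⟩
    · rw [div_le_iff₀ hC.2.1]
      linarith [h C hC.1.1 hC.1.2]
    · rw [le_div_iff_of_neg hC.2.1]
      linarith [h C hC.1.1 hC.1.2]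
  · rintro ⟨hd, hu⟩ C hC hCP
    rcases lt_or_ge (Gam μ P φ C) 0 with hG | hG
    · have hDC : 0 < Dcoef P C := by
        by_contra! hDC
        have : C ∈ Bmm μ P φ := ⟨⟨hC, hCP⟩, hDC, hG⟩
        simp [hBmm] at this
      have := hd C ⟨⟨hC, hCP⟩, hDC, hG⟩
      rw [div_le_iff₀ hDC] at this
      linarith
    · rcases lt_or_ge (Dcoef P C) 0 with hDC | hDC
      · have := hu C ⟨⟨hC, hCP⟩, hDC, hG⟩
        rw [le_div_iff_of_neg hDC] at this
        linarith
      · positivity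

end CG

open CG in
/-- if `B^{--} = ∅` and `β̄_d^P(φ) ≤ β̄_u^P(φ)`, then `(P, φ)` is stable
at cost `β` iff `β ∈ [β̄_d^P(φ), β̄_u^P(φ)]`. -/
theorem stmt4 {N M : ℕ} (hN : 2 ≤ N) (hMN : N ≤ M)
    (μ : Fin M → ℕ → ℝ)
    (hpos : ∀ a : Fin M, ∀ k : ℕ, 1 ≤ k → k ≤ N → 0 < μ a k)
    (hmono : ∀ a b : Fin M, a ≤ b → μ b 1 ≤ μ a 1)
    (P : Finset (Finset (Fin N))) (hP : IsPartition P)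
    (φ : Fin N → Fin M) (hφ : IsNE μ 0 P φ)
    (hBmm : Bmm μ P φ = ∅)
    (hdu : betaD μ P φ ≤ betaU μ P φ)
    (β : ℝ) (hβ : 0 ≤ β) :
    PairStable μ β P φ ↔
      betaD μ P φ ≤ (β : EReal) ∧ (β : EReal) ≤ betaU μ P φ := by
  exact (pairStable_iff_forall_Gam hpos hP hφ hβ).trans (forall_Gam_iff hBmm hβ)
end

section
/- Assume M ≥ N, equi-divisible congestion, and (when M > N) μ_N > μ_{N+1}. Suppose μ₁/2 > μ_k for some 2 ≤ k ≤ N. Then at β = 0, every partition P with |P| ≥ k is blocked by the grand coalition G and hence is not stable at β = 0. In particular, for every such P there is no Nash equilibrium of P in which all players use distinct links, so the total worth at any NE of P is strictly less than Σ_{i=1}^N μ_i = ν̲_G. -/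
open Finset

namespace CG

variable {N M : ℕ}

lemma gamma_eq_one_of_injective {φ : Fin N → Fin M} (hφ : Function.Injective φ) (i : Fin N) :
    gamma φ (φ i) = 1 := by
  rw [gamma, Finset.card_eq_one]
  exact ⟨i, by ext j; simp [hφ.eq_iff]⟩

lemma one_le_gamma (φ : Fin N → Fin M) (i : Fin N) : 1 ≤ gamma φ (φ i) :=
  Finset.card_pos.mpr ⟨i, by simp⟩

/-- Under equi-divisible congestion, the total reward is the sum of the solo rewards of the
occupied links. -/
lemma sum_reward_eq_sum_image {μ : Fin M → ℕ → ℝ}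
    (hequi : ∀ a : Fin M, ∀ k : ℕ, 1 ≤ k → μ a k = μ a 1 / k) (φ : Fin N → Fin M) :
    ∑ i, μ (φ i) (gamma φ (φ i)) = ∑ a ∈ Finset.univ.image φ, μ a 1 := by
  symm
  refine Finset.sum_image' (g := φ) (f := fun a => μ a 1) _ fun i _ => ?_
  have hconst : ∀ j ∈ Finset.univ.filter (fun j => φ j = φ i),
      μ (φ j) (gamma φ (φ j)) = μ (φ i) 1 / gamma φ (φ i) := by
    intro j hj
    rw [(Finset.mem_filter.mp hj).2, hequi _ _ (one_le_gamma φ i)]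
  have hne : (gamma φ (φ i) : ℝ) ≠ 0 := by
    exact_mod_cast Nat.one_le_iff_ne_zero.mp (one_le_gamma φ i)
  rw [Finset.sum_congr rfl hconst, Finset.sum_const, nsmul_eq_mul]
  change _ = (gamma φ (φ i) : ℝ) * _
  field_simp

lemma util_zero (μ : Fin M → ℕ → ℝ) (C : Finset (Fin N)) (φ : Fin N → Fin M) :
    util μ 0 C φ = ∑ i ∈ C, μ (φ i) (gamma φ (φ i)) := by
  simp [util]

lemma IsPartition.sum_eq {P : Finset (Finset (Fin N))} (hP : IsPartition P) (f : Fin N → ℝ) :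
    ∑ C ∈ P, ∑ i ∈ C, f i = ∑ i, f i := by
  have hU : P.biUnion id = Finset.univ := by
    ext i
    simpa using hP.2.2 i
  rw [← hU]
  exact (Finset.sum_biUnion fun C hC D hD hne => hP.2.1 C hC D hD hne).symm

/-- In a partition, the blocks other than `C` are at most as many as the players outside `C`. -/
lemma IsPartition.card_le {P : Finset (Finset (Fin N))} (hP : IsPartition P)
    {C : Finset (Fin N)} (hC : C ∈ P) : P.card ≤ Cᶜ.card + 1 := by
  have hU : (P.erase C).biUnion id ⊆ Cᶜ := by
    intro i hi
    obtain ⟨D, hD, hiD⟩ := Finset.mem_biUnion.mp hi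
    have hD' := Finset.mem_erase.mp hD
    exact Finset.mem_compl.mpr
      (Finset.disjoint_left.mp (hP.2.1 D hD'.2 C hC hD'.1) hiD)
  have hcard : (P.erase C).card ≤ ((P.erase C).biUnion id).card :=
    Finset.card_le_card_biUnion
      (fun D hD E hE hne => hP.2.1 D (Finset.mem_of_mem_erase hD) E
        (Finset.mem_of_mem_erase hE) hne)
      (fun D hD => hP.1 D (Finset.mem_of_mem_erase hD))
  have h1 := Finset.card_erase_add_one hC
  have h2 := Finset.card_le_card hU
  omega

/-- The first `N` links. -/
def topLinks (hMN : N ≤ M) : Finset (Fin M) :=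
  Finset.univ.image (Fin.castLE hMN)

lemma mem_topLinks {hMN : N ≤ M} {a : Fin M} : a ∈ topLinks hMN ↔ a.val < N := by
  simp only [topLinks, Finset.mem_image, Finset.mem_univ, true_and]
  exact ⟨fun ⟨i, hi⟩ => hi ▸ i.isLt, fun h => ⟨⟨a.val, h⟩, rfl⟩⟩

lemma card_topLinks (hMN : N ≤ M) : (topLinks hMN).card = N := by
  rw [topLinks, Finset.card_image_of_injective _ (Fin.castLE_injective hMN)]
  simp

lemma sum_topLinks (hMN : N ≤ M) (f : Fin M → ℝ) :
    ∑ a ∈ topLinks hMN, f a = ∑ i, f (Fin.castLE hMN i) :=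
  Finset.sum_image fun _ _ _ _ h => Fin.castLE_injective hMN h

/-- If all values on `T` are at least `c > 0` and all values off `T` are strictly below `c`, then
`T` is the unique heaviest set among those of at most its cardinality. -/
lemma sum_lt_sum_of_threshold {α : Type*} [DecidableEq α] {f : α → ℝ} {c : ℝ} {T I : Finset α}
    (hc : 0 < c) (hT : ∀ a ∈ T, c ≤ f a) (hI : ∀ a ∉ T, f a < c) (hcard : I.card ≤ T.card)
    (hne : I ≠ T) : ∑ a ∈ I, f a < ∑ a ∈ T, f a := by
  rw [← Finset.sum_sdiff_lt_sum_sdiff]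
  have hcard' := Finset.card_sdiff_le_card_sdiff_iff.mpr hcard
  have hlow : ((T \ I).card : ℝ) * c ≤ ∑ a ∈ T \ I, f a := by
    rw [← nsmul_eq_mul]
    exact Finset.card_nsmul_le_sum _ _ _ fun a ha => hT a (Finset.mem_sdiff.mp ha).1
  have hposT : 0 < (T \ I).card := by
    rw [Finset.card_pos, Finset.sdiff_nonempty]
    exact fun h => hne (Finset.eq_of_subset_of_card_le h hcard).symm
  rcases (I \ T).eq_empty_or_nonempty with h | h
  · rw [h, Finset.sum_empty]
    have : (0 : ℝ) < (T \ I).card := by exact_mod_cast hposT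
    nlinarith
  · have hup : ∑ a ∈ I \ T, f a < ((I \ T).card : ℝ) * c := by
      rw [← nsmul_eq_mul, ← Finset.sum_const]
      exact Finset.sum_lt_sum_of_nonempty h fun a ha => hI a (Finset.mem_sdiff.mp ha).2
    have : ((I \ T).card : ℝ) ≤ (T \ I).card := by exact_mod_cast hcard'
    nlinarith

/-- From an injective equilibrium, a player does not gain by moving to a link that is not used by
her own coalition. -/
lemma IsNE.reward_update_le {μ : Fin M → ℕ → ℝ} {P : Finset (Finset (Fin N))}
    {φ : Fin N → Fin M} (hNE : IsNE μ 0 P φ) (hφ : Function.Injective φ)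
    {C : Finset (Fin N)} (hC : C ∈ P) {i : Fin N} (hi : i ∈ C) {b : Fin M}
    (hb : ∀ j ∈ C, φ j ≠ b) :
    μ b (gamma (Function.update φ i b) b) ≤ μ (φ i) 1 := by
  have h := hNE C hC (Function.update φ i b) fun j hj =>
    Function.update_of_ne (fun hji : j = i => hj (hji ▸ hi)) _ _
  rw [util_zero, util_zero, ← Finset.add_sum_erase _ _ hi, ← Finset.add_sum_erase _ _ hi] at h
  have hrest : ∀ j ∈ C.erase i,
      μ (Function.update φ i b j) (gamma (Function.update φ i b) (Function.update φ i b j)) =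
        μ (φ j) (gamma φ (φ j)) := by
    intro j hj
    obtain ⟨hji, hjC⟩ := Finset.mem_erase.mp hj
    rw [Function.update_of_ne hji, gamma_eq_one_of_injective hφ]
    congr 1
    rw [gamma, Finset.card_eq_one]
    refine ⟨j, ?_⟩
    ext l
    rcases eq_or_ne l i with rfl | hl
    · simp [(hb j hjC).symm, hji.symm]
    · simp [Function.update_of_ne hl, hφ.eq_iff]
  rw [Finset.sum_congr rfl hrest, Function.update_self, gamma_eq_one_of_injective hφ] at h
  linarith

lemma gamma_update_of_notMem_range {φ : Fin N → Fin M} {b : Fin M} (hb : ∀ j, φ j ≠ b)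
    (i : Fin N) : gamma (Function.update φ i b) b = 1 := by
  rw [gamma, Finset.card_eq_one]
  refine ⟨i, ?_⟩
  ext l
  rcases eq_or_ne l i with rfl | hl
  · simp
  · simp [hb, hl]

lemma gamma_update_of_injective {φ : Fin N → Fin M} (hφ : Function.Injective φ) {i j : Fin N}
    (hij : i ≠ j) : gamma (Function.update φ i (φ j)) (φ j) = 2 := by
  rw [gamma, Finset.card_eq_two]
  refine ⟨i, j, hij, ?_⟩
  ext l
  rcases eq_or_ne l i with rfl | hl
  · simp
  · simp [hφ.eq_iff, hl]

/-- If `T` consists of `N` links, each strictly better than every link outside `T`, then an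
injective equilibrium occupies exactly the links of `T`. -/
lemma IsNE.image_eq {μ : Fin M → ℕ → ℝ} {P : Finset (Finset (Fin N))} {φ : Fin N → Fin M}
    (hP : IsPartition P) (hNE : IsNE μ 0 P φ) (hφ : Function.Injective φ) {T : Finset (Fin M)}
    (hT : T.card = N) (hlt : ∀ a ∉ T, ∀ b ∈ T, μ a 1 < μ b 1) :
    Finset.univ.image φ = T := by
  have hcard : (Finset.univ.image φ).card = N := by
    simp [Finset.card_image_of_injective _ hφ]
  refine Finset.eq_of_subset_of_card_le (fun a ha => ?_) (by omega)
  by_contra haT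
  have hsub : ¬ T ⊆ Finset.univ.image φ := fun h =>
    haT (Finset.eq_of_subset_of_card_le h (by omega) ▸ ha)
  obtain ⟨b, hbT, hb⟩ := Finset.not_subset.mp hsub
  obtain ⟨i, -, rfl⟩ := Finset.mem_image.mp ha
  have hb' : ∀ j, φ j ≠ b := fun j hj => hb (Finset.mem_image.mpr ⟨j, Finset.mem_univ _, hj⟩)
  obtain ⟨C, hC, hi⟩ := hP.2.2 i
  have h := hNE.reward_update_le hφ hC hi fun j _ => hb' j
  rw [gamma_update_of_notMem_range hb'] at h
  exact absurd (hlt _ haT _ hbT) h.not_gt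

/-- When half the best reward beats that of the `k`-th link, no equilibrium of a partition with at
least `k` blocks occupies exactly the first `N` links. -/
lemma IsNE.image_ne_topLinks {μ : Fin M → ℕ → ℝ} {P : Finset (Finset (Fin N))}
    {φ : Fin N → Fin M} (hMN : N ≤ M) (hmono : ∀ a b : Fin M, a ≤ b → μ b 1 ≤ μ a 1)
    (hequi : ∀ a : Fin M, ∀ k : ℕ, 1 ≤ k → μ a k = μ a 1 / k)
    {k : ℕ} (hk2 : 2 ≤ k) (hkN : k ≤ N) {best b : Fin M} (hbest : best.val = 0)
    (hb : b.val = k - 1) (hbig : μ b 1 < μ best 1 / 2)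
    (hP : IsPartition P) (hkP : k ≤ P.card) (hNE : IsNE μ 0 P φ) :
    Finset.univ.image φ ≠ topLinks hMN := by
  intro himg
  have hφ : Function.Injective φ := by
    have : (Finset.univ.image φ).card = (Finset.univ : Finset (Fin N)).card := by
      rw [himg, card_topLinks]
      simp
    simpa using Finset.card_image_iff.mp this
  have hmem : best ∈ Finset.univ.image φ := by
    rw [himg, mem_topLinks]
    omega
  obtain ⟨i₀, -, hi₀⟩ := Finset.mem_image.mp hmem
  obtain ⟨C₀, hC₀, hiC₀⟩ := hP.2.2 i₀
  have hval : (φ i₀).val = 0 := hi₀ ▸ hbest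
  obtain ⟨i, hi, hik⟩ : ∃ i ∉ C₀, k - 1 ≤ (φ i).val := by
    by_contra! hcon
    have hle : C₀ᶜ.card ≤ (Finset.Icc 1 (k - 2)).card := by
      refine Finset.card_le_card_of_injOn (fun i => (φ i).val) (fun i hi => ?_)
        (fun a _ b _ hab => hφ (Fin.ext hab))
      have hiC : i ∉ C₀ := by simpa using hi
      have h1 := hcon i hiC
      have h2 : (φ i).val ≠ 0 := fun h0 =>
        hiC (hφ (Fin.ext (h0.trans hval.symm)) ▸ hiC₀)
      simp only [Finset.coe_Icc, Set.mem_Icc]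
      omega
    rw [Nat.card_Icc] at hle
    have := hP.card_le hC₀
    omega
  obtain ⟨C, hC, hiC⟩ := hP.2.2 i
  have hCne : C ≠ C₀ := fun h => hi (h ▸ hiC)
  have hne : i ≠ i₀ := fun h => hi (h ▸ hiC₀)
  have h := hNE.reward_update_le (b := φ i₀) hφ hC hiC fun j hj hj0 =>
    Finset.disjoint_left.mp (hP.2.1 C hC C₀ hC₀ hCne) hj (hφ hj0 ▸ hiC₀)
  rw [gamma_update_of_injective hφ hne, hequi _ 2 (by norm_num), hi₀] at h
  have hle := hmono b (φ i) (by rw [Fin.le_def, hb]; exact hik)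
  push_cast at h
  linarith

/-- If an injective profile realises the heaviest possible set of occupied links, the pessimal
worth of the grand coalition is the total value of that set. -/
lemma pess_univ_eq {μ : Fin M → ℕ → ℝ} {S : ℝ} (hN : 0 < N)
    {φ₀ : Fin N → Fin M} (hφ₀ : util μ 0 Finset.univ φ₀ = S)
    (hle : ∀ φ : Fin N → Fin M, util μ 0 Finset.univ φ ≤ S) :
    pess μ 0 (Finset.univ : Finset (Fin N)) = S := by
  have hset : {x : ℝ | ∃ P' : Finset (Finset (Fin N)), ∃ φ' : Fin N → Fin M,
      IsPartition P' ∧ Finset.univ ∈ P' ∧ IsNE μ 0 P' φ' ∧ x = util μ 0 Finset.univ φ'} = {S} := by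
    ext x
    simp only [Set.mem_ofPred_eq, Set.mem_singleton_iff]
    constructor
    · rintro ⟨P', φ', -, hG, hNE, rfl⟩
      exact le_antisymm (hle φ') (hφ₀ ▸ hNE _ hG φ₀ (by simp))
    · rintro rfl
      refine ⟨{Finset.univ}, φ₀, ⟨?_, ?_, ?_⟩, by simp, ?_, hφ₀.symm⟩
      · simp only [Finset.mem_singleton, forall_eq]
        exact ⟨⟨0, hN⟩, Finset.mem_univ _⟩
      · intro C hC C' hC' hne
        exact absurd ((Finset.mem_singleton.mp hC).trans (Finset.mem_singleton.mp hC').symm) hne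
      · simp
      · intro C hC φ' _
        rw [Finset.mem_singleton.mp hC, hφ₀]
        exact hle φ'
  rw [pess, hset, csInf_singleton]

end CG

open CG in
/-- with equi-divisible congestion and `μ₁/2 > μ_k` for some
`2 ≤ k ≤ N`, every partition `P` with `|P| ≥ k` has no NE with all-distinct links,
its total worth at any NE is `< Σ μ_i = ν̲_G`, and it is blocked by the grand
coalition at `β = 0`, hence not stable at `β = 0`. -/
theorem stmt15 {N M : ℕ} (hN : 2 ≤ N) (hMN : N ≤ M)
    (μ : Fin M → ℕ → ℝ)
    (hpos : ∀ a : Fin M, ∀ k : ℕ, 1 ≤ k → k ≤ N → 0 < μ a k)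
    (hmono : ∀ a b : Fin M, a ≤ b → μ b 1 ≤ μ a 1)
    (hequi : ∀ a : Fin M, ∀ k : ℕ, 1 ≤ k → μ a k = μ a 1 / k)
    (hgap : ∀ h : N < M, μ (⟨N, h⟩ : Fin M) 1 < μ (Fin.castLE hMN ⟨N - 1, by omega⟩) 1)
    (k : ℕ) (hk2 : 2 ≤ k) (hkN : k ≤ N)
    (hbig : μ (Fin.castLE hMN ⟨k - 1, by omega⟩) 1 <
      μ (Fin.castLE hMN ⟨0, by omega⟩) 1 / 2) :
    pess μ 0 (Finset.univ : Finset (Fin N)) = (∑ i : Fin N, μ (Fin.castLE hMN i) 1) ∧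
    ∀ P : Finset (Finset (Fin N)), IsPartition P → k ≤ P.card →
      (∀ φ : Fin N → Fin M, IsNE μ 0 P φ → ¬ Function.Injective φ) ∧
      (∀ φ : Fin N → Fin M, IsNE μ 0 P φ →
        ∑ C ∈ P, util μ 0 C φ < ∑ i : Fin N, μ (Fin.castLE hMN i) 1) ∧
      (∀ φ : Fin N → Fin M, ∀ ψ : Fin N → ℝ, IsNE μ 0 P φ → Consistent μ 0 P φ ψ →
        Blocks μ 0 P ψ (Finset.univ : Finset (Fin N))) ∧
      ¬ PartStable μ 0 P := by
  set S := ∑ i : Fin N, μ (Fin.castLE hMN i) 1 with hS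
  set c := μ (Fin.castLE hMN ⟨N - 1, by omega⟩) 1 with hc
  have hcpos : 0 < c := hpos _ 1 le_rfl (by omega)
  have hTop : ∀ a ∈ topLinks hMN, c ≤ μ a 1 := fun a ha => by
    refine hmono _ _ ?_
    have := mem_topLinks.mp ha
    simp only [Fin.le_def, Fin.val_castLE]
    omega
  have hOff : ∀ a ∉ topLinks hMN, μ a 1 < c := fun a ha => by
    have h1 : N ≤ a.val := not_lt.mp (mt mem_topLinks.mpr ha)
    have h2 : N < M := h1.trans_lt a.isLt
    exact (hmono ⟨N, h2⟩ a h1).trans_lt (hgap h2)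
  have hlt : ∀ φ : Fin N → Fin M, Finset.univ.image φ ≠ topLinks hMN →
      ∑ i, μ (φ i) (gamma φ (φ i)) < S := fun φ hne => by
    rw [sum_reward_eq_sum_image hequi, hS, ← sum_topLinks hMN fun a => μ a 1]
    refine sum_lt_sum_of_threshold hcpos hTop hOff ?_ hne
    rw [card_topLinks]
    simpa using Finset.card_image_le (s := Finset.univ) (f := φ)
  have heq : ∀ φ : Fin N → Fin M, Finset.univ.image φ = topLinks hMN →
      ∑ i, μ (φ i) (gamma φ (φ i)) = S := fun φ h => by
    rw [sum_reward_eq_sum_image hequi, h, sum_topLinks]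
  have hpess : pess μ 0 (Finset.univ : Finset (Fin N)) = S := by
    refine pess_univ_eq (by omega) (φ₀ := Fin.castLE hMN) ?_ fun φ => ?_
    · rw [util_zero]
      exact heq _ rfl
    · rw [util_zero]
      by_cases h : Finset.univ.image φ = topLinks hMN
      exacts [(heq φ h).le, (hlt φ h).le]
  refine ⟨hpess, fun P hP hkP => ?_⟩
  have hne : ∀ φ : Fin N → Fin M, IsNE μ 0 P φ → Finset.univ.image φ ≠ topLinks hMN :=
    fun φ hNE => hNE.image_ne_topLinks hMN hmono hequi hk2 hkN rfl rfl hbig hP hkP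
  have htot : ∀ φ : Fin N → Fin M, IsNE μ 0 P φ → ∑ C ∈ P, util μ 0 C φ < S :=
    fun φ hNE => by
      simp only [util_zero]
      rw [hP.sum_eq fun i => μ (φ i) (gamma φ (φ i))]
      exact hlt φ (hne φ hNE)
  have hblock : ∀ φ : Fin N → Fin M, ∀ ψ : Fin N → ℝ, IsNE μ 0 P φ → Consistent μ 0 P φ ψ →
      Blocks μ 0 P ψ (Finset.univ : Finset (Fin N)) := by
    intro φ ψ hNE hψ
    refine ⟨⟨⟨0, by omega⟩, Finset.mem_univ _⟩, fun hG => ?_, ?_⟩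
    · have := hP.card_le hG
      simp only [Finset.compl_univ, Finset.card_empty] at this
      omega
    · rw [hpess, ← hP.sum_eq, Finset.sum_congr rfl hψ.2]
      exact htot φ hNE
  refine ⟨fun φ hNE hφ => hne φ hNE ?_, htot, hblock, ?_⟩
  · exact hNE.image_eq hP hφ (card_topLinks hMN) fun a ha b hb =>
      (hOff a ha).trans_le (hTop b hb)
  · rintro ⟨φ, ψ, -, hNE, hψ, hstable⟩
    exact hstable _ (hblock φ ψ hNE hψ)
end
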